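/- arXiv:2402.15094 — 6 statements merged into one kernel-verified Lean document; each statement's English description precedes it below -/
import Mathlib

section
/- Let R be a commutative ring, n ≥ 1, and a, b ∈ Rⁿ. Then S_n(a,b) · \overline{S_n(a,b)} = ⟨a,b⟩ · Id_{2^{n-1}}, where Id_{2^{n-1}} is the identity 2^{n-1} × 2^{n-1} matrix. -/
open Matrix

variable {R : Type*} [CommRing R]

/-- The index equivalence `Fin (2^n) ⊕ Fin (2^n) ≃ Fin (2^(n+1))` used to assemble
block matrices. -/
def suslinEquiv (n : ℕ) : Fin (2 ^ n) ⊕ Fin (2 ^ n) ≃ Fin (2 ^ (n + 1)) :=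
  finSumFinEquiv.trans (finCongr (by rw [pow_succ, mul_two]))

/-- The Suslin matrix `S_{n+1}(a, b) ∈ M_{2^n}(R)` of a pair of vectors `a, b ∈ R^{n+1}`,
defined inductively by `S₁(a,b) = (a₁)` and
`S_{n+1}(a,b) = [[a₁·Id, S_n(a',b')], [−S_n(b',a')ᵗ, b₁·Id]]`. -/
def suslin : (n : ℕ) → (Fin (n + 1) → R) → (Fin (n + 1) → R) →
    Matrix (Fin (2 ^ n)) (Fin (2 ^ n)) R
  | 0, a, _ => Matrix.of fun _ _ => a 0
  | n + 1, a, b =>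
      Matrix.reindex (suslinEquiv n) (suslinEquiv n)
        (Matrix.fromBlocks
          (a 0 • (1 : Matrix (Fin (2 ^ n)) (Fin (2 ^ n)) R))
          (suslin n (a ∘ Fin.succ) (b ∘ Fin.succ))
          (-(suslin n (b ∘ Fin.succ) (a ∘ Fin.succ))ᵀ)
          (b 0 • (1 : Matrix (Fin (2 ^ n)) (Fin (2 ^ n)) R)))

/-- The conjugate Suslin matrix `\overline{S_{n+1}(a, b)} ∈ M_{2^n}(R)`, defined inductively by
`\overline{S₁(a,b)} = (b₁)` and
`\overline{S_{n+1}(a,b)} = [[b₁·Id, −S_n(a',b')], [S_n(b',a')ᵗ, a₁·Id]]`. -/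
def suslinBar : (n : ℕ) → (Fin (n + 1) → R) → (Fin (n + 1) → R) →
    Matrix (Fin (2 ^ n)) (Fin (2 ^ n)) R
  | 0, _, b => Matrix.of fun _ _ => b 0
  | n + 1, a, b =>
      Matrix.reindex (suslinEquiv n) (suslinEquiv n)
        (Matrix.fromBlocks
          (b 0 • (1 : Matrix (Fin (2 ^ n)) (Fin (2 ^ n)) R))
          (-(suslin n (a ∘ Fin.succ) (b ∘ Fin.succ)))
          ((suslin n (b ∘ Fin.succ) (a ∘ Fin.succ))ᵀ)
          (a 0 • (1 : Matrix (Fin (2 ^ n)) (Fin (2 ^ n)) R)))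

/-- The conjugate Suslin matrix is the transpose of the Suslin matrix with `a` and `b` swapped. -/
theorem transpose_suslin_eq_suslinBar (n : ℕ) (a b : Fin (n + 1) → R) :
    (suslin n b a)ᵀ = suslinBar n a b := by
  cases n with
  | zero => rfl
  | succ n => simp [suslin, suslinBar, fromBlocks_transpose]

/-- A Suslin matrix commutes with the transpose of its swapped companion, and both products
are the scalar matrix `⟨a, b⟩ · Id`. -/
theorem suslin_mul_transpose_suslin (n : ℕ) (a b : Fin (n + 1) → R) :
    suslin n a b * (suslin n b a)ᵀ = (∑ i, a i * b i) • 1 ∧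
      (suslin n b a)ᵀ * suslin n a b = (∑ i, a i * b i) • 1 := by
  induction n with
  | zero =>
    have : Subsingleton (Fin (2 ^ 0)) := inferInstanceAs (Subsingleton (Fin 1))
    constructor <;> ext i j <;> simp [suslin, mul_apply, Subsingleton.elim i j, mul_comm]
  | succ n ih =>
    obtain ⟨h₁, h₂⟩ := ih (a ∘ Fin.succ) (b ∘ Fin.succ)
    have hsmul (c : R) : c • (1 : Matrix (Fin (2 ^ (n + 1))) (Fin (2 ^ (n + 1))) R) =
        (fromBlocks (c • 1) 0 0 (c • 1)).submatrix (suslinEquiv n).symm (suslinEquiv n).symm := by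
      rw [← smul_zero c, ← fromBlocks_smul, fromBlocks_one, submatrix_smul]
      simp
    rw [hsmul, Fin.sum_univ_succ]
    constructor <;>
      simp [suslin, fromBlocks_transpose, fromBlocks_multiply, h₁, h₂, smul_smul, add_smul,
        mul_comm (b 0), add_comm]

/-- `S_n(a,b) · \overline{S_n(a,b)} = ⟨a,b⟩ · Id` for all `n ≥ 1`
(here vectors have length `n + 1`, so all lengths `≥ 1` are covered). -/
theorem suslin_mul_suslinBar (n : ℕ) (a b : Fin (n + 1) → R) :
    suslin n a b * suslinBar n a b
      = (∑ i, a i * b i) • (1 : Matrix (Fin (2 ^ n)) (Fin (2 ^ n)) R) := by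
  rw [← transpose_suslin_eq_suslinBar]
  exact (suslin_mul_transpose_suslin n a b).1
end

section
/- Let R be a commutative ring, n ≥ 1, and a, b ∈ Rⁿ. Then \overline{S_n(a,b)} · S_n(a,b) = ⟨a,b⟩ · Id_{2^{n-1}}, where Id_{2^{n-1}} is the identity 2^{n-1} × 2^{n-1} matrix. -/
open Matrix

variable {R : Type*} [CommRing R]

theorem suslinBar_eq_transpose (n : ℕ) (a b : Fin (n + 1) → R) :
    suslinBar n a b = (suslin n b a)ᵀ := by
  cases n with
  | zero => rfl
  | succ n =>
    simp [suslin, suslinBar, fromBlocks_transpose, transpose_submatrix]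

theorem suslin_mul_transpose_and_transpose_mul (n : ℕ) (a b : Fin (n + 1) → R) :
    suslin n a b * (suslin n b a)ᵀ
        = (∑ i, a i * b i) • (1 : Matrix (Fin (2 ^ n)) (Fin (2 ^ n)) R) ∧
      (suslin n b a)ᵀ * suslin n a b
        = (∑ i, a i * b i) • (1 : Matrix (Fin (2 ^ n)) (Fin (2 ^ n)) R) := by
  induction n with
  | zero =>
    constructor <;> ext i j <;> fin_cases i <;> fin_cases j <;>
      simp [suslin, mul_apply, mul_comm]
  | succ n ih =>
    obtain ⟨h₁, h₂⟩ := ih (a ∘ Fin.succ) (b ∘ Fin.succ)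
    have smul_one_eq (c : R) : c • (1 : Matrix (Fin (2 ^ (n + 1))) (Fin (2 ^ (n + 1))) R)
        = (fromBlocks (c • 1) 0 0 (c • 1)).submatrix (suslinEquiv n).symm
          (suslinEquiv n).symm := by
      rw [← smul_zero c, ← fromBlocks_smul, fromBlocks_one, submatrix_smul]
      simp
    rw [smul_one_eq, Fin.sum_univ_succ]
    simp only [suslin, reindex_apply, transpose_submatrix, fromBlocks_transpose,
      submatrix_mul_equiv, fromBlocks_multiply]
    constructor <;> congr 2 <;>
      simp [h₁, h₂, add_smul, smul_smul, mul_comm, add_comm]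

/-- `\overline{S_n(a,b)} · S_n(a,b) = ⟨a,b⟩ · Id` for all `n ≥ 1`
(here vectors have length `n + 1`, so all lengths `≥ 1` are covered). -/
theorem suslinBar_mul_suslin (n : ℕ) (a b : Fin (n + 1) → R) :
    suslinBar n a b * suslin n a b
      = (∑ i, a i * b i) • (1 : Matrix (Fin (2 ^ n)) (Fin (2 ^ n)) R) := by
  rw [suslinBar_eq_transpose]
  exact (suslin_mul_transpose_and_transpose_mul n a b).2
end

section
/- Let R be a commutative ring, n ≥ 1, and a, b ∈ Rⁿ. Then for n = 1, det S₁(a,b) = a₁, and for n ≥ 2, det(S_n(a,b)) = ⟨a,b⟩^{2^{n-2}}; equivalently, for all n ≥ 2 the determinant of the 2^{n-1} × 2^{n-1} matrix S_n(a,b) equals (Σᵢ aᵢbᵢ)^{2^{n-2}}. -/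
open Matrix

variable {R : Type*} [CommRing R]

open Polynomial in
/-- The determinant of a block matrix whose lower right block is scalar. -/
theorem det_fromBlocks_smul_one₂₂ {m : Type*} [Fintype m] [DecidableEq m]
    (A B C : Matrix m m R) (d : R) :
    (fromBlocks A B C (d • 1)).det = (d • A - B * C).det := by
  have key (S : Type _) [CommRing S] (A B C : Matrix m m S) (d : S) :
      (fromBlocks A B C (d • 1)).det * d ^ Fintype.card m =
        (d • A - B * C).det * d ^ Fintype.card m := by
    have h : fromBlocks A B C (d • 1) * fromBlocks (d • 1) 0 (-C) 1 =
        fromBlocks (d • A - B * C) B 0 (d • 1) := by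
      simp [fromBlocks_multiply, sub_eq_add_neg]
    simpa using congrArg Matrix.det h
  let f : R →+* R[X] := Polynomial.C
  let e : R[X] →+* R := evalRingHom 0
  have hreg : IsRegular ((X + Polynomial.C d : R[X]) ^ Fintype.card m) :=
    ((monic_X_add_C d).pow _).isRegular
  have h := congrArg e (hreg.right (key R[X] (A.map f) (B.map f) (C.map f) (X + Polynomial.C d)))
  have hef (M : Matrix m m R) : (M.map f).map e = M := by
    ext; simp [e, f]
  have hd : e (X + Polynomial.C d) = d := by simp [e]
  have hsmul (M : Matrix m m R[X]) : ((X + Polynomial.C d) • M).map e = d • M.map e := by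
    rw [Matrix.map_smul' e _ _ (map_mul e), hd]
  rw [RingHom.map_det, RingHom.map_det, RingHom.mapMatrix_apply, RingHom.mapMatrix_apply,
    fromBlocks_map, Matrix.map_sub e (map_sub e), hsmul, hsmul, Matrix.map_mul,
    Matrix.map_one e (map_zero e) (map_one e)] at h
  simpa only [hef] using h

/-- `S_n(a,b) S_n(b,a)ᵗ = ⟨a,b⟩ Id`. -/
theorem suslin_mul_transpose (n : ℕ) (a b : Fin (n + 1) → R) :
    suslin n a b * (suslin n b a)ᵀ = (∑ i, a i * b i) • 1 := by
  suffices h : suslin n a b * (suslin n b a)ᵀ = (∑ i, a i * b i) • 1 ∧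
      (suslin n b a)ᵀ * suslin n a b = (∑ i, a i * b i) • 1 from h.1
  induction n with
  | zero =>
    have : Subsingleton (Fin (2 ^ 0)) := inferInstanceAs (Subsingleton (Fin 1))
    constructor <;> ext i j <;> obtain rfl := Subsingleton.elim i j <;>
      simp [suslin, Matrix.mul_apply, mul_comm]
  | succ n ih =>
    obtain ⟨h₁, h₂⟩ := ih (a ∘ Fin.succ) (b ∘ Fin.succ)
    have hs : (∑ i, a i * b i) =
        a 0 * b 0 + ∑ i, (a ∘ Fin.succ) i * (b ∘ Fin.succ) i := by
      simp [Fin.sum_univ_succ]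
    have hone (c : R) : (c • 1 : Matrix (Fin (2 ^ (n + 1))) (Fin (2 ^ (n + 1))) R) =
        Matrix.reindex (suslinEquiv n) (suslinEquiv n) (fromBlocks (c • 1) 0 0 (c • 1)) := by
      rw [← smul_zero c, ← fromBlocks_smul, fromBlocks_one]
      simp [Matrix.submatrix_smul]
    rw [hs, hone]
    constructor <;>
    · simp only [suslin, Matrix.reindex_apply, Matrix.transpose_submatrix,
        Matrix.submatrix_mul_equiv, fromBlocks_transpose, fromBlocks_multiply]
      congr 1
      simp [h₁, h₂, add_smul, smul_smul, mul_comm, add_comm]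

/-- `det S₁(a,b) = a₁`, and for all `n ≥ 2`,
`det S_n(a,b) = ⟨a,b⟩^{2^{n-2}}` (here the case `n ≥ 2` is expressed with vectors of
length `n + 2`, i.e. the matrix `suslin (n+1) a b` of size `2^{n+1}`). -/
theorem det_suslin :
    (∀ a b : Fin 1 → R, (suslin 0 a b).det = a 0) ∧
      ∀ (n : ℕ) (a b : Fin (n + 2) → R),
        (suslin (n + 1) a b).det = (∑ i, a i * b i) ^ 2 ^ n := by
  refine ⟨fun a b => by simp [suslin], fun n a b => ?_⟩
  rw [suslin, Matrix.det_reindex_self, det_fromBlocks_smul_one₂₂, Matrix.mul_neg,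
    suslin_mul_transpose, smul_smul, sub_neg_eq_add, ← add_smul, mul_comm (b 0),
    Fin.sum_univ_succ (fun i => a i * b i)]
  simp
end

section
/- Let R be a commutative ring, n ≥ 1, and a = (a₁,…,a_n), b = (b₁,…,b_n) ∈ Rⁿ. Then \overline{S_n(a,b)} = S_n((b₁, −a₂, …, −a_n), (a₁, −b₂, …, −b_n)); that is, the conjugate Suslin matrix of (a,b) is itself a Suslin matrix, of the pair of vectors obtained by exchanging a₁ and b₁ and negating the remaining coordinates. -/
open Matrix

variable {R : Type*} [CommRing R]

theorem suslin_neg (n : ℕ) (a b : Fin (n + 1) → R) : suslin n (-a) (-b) = -suslin n a b := by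
  induction n with
  | zero => rfl
  | succ n ih =>
    have neg_comp (v : Fin (n + 2) → R) : (-v) ∘ Fin.succ = -(v ∘ Fin.succ) := rfl
    simp only [suslin, neg_comp, ih, Pi.neg_apply, neg_smul, Matrix.transpose_neg,
      Matrix.reindex_apply, ← Matrix.fromBlocks_neg, Matrix.submatrix_neg]

/-- `\overline{S_n(a,b)} = S_n((b₁, −a₂, …, −a_n), (a₁, −b₂, …, −b_n))`
for all `n ≥ 1` (vectors here have length `n + 1 ≥ 1`). -/
theorem suslinBar_eq_suslin (n : ℕ) (a b : Fin (n + 1) → R) :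
    suslinBar n a b
      = suslin n (Fin.cons (b 0) fun i => -a i.succ) (Fin.cons (a 0) fun i => -b i.succ) := by
  cases n with
  | zero => rfl
  | succ n =>
    have cons_neg_comp (x : R) (v : Fin (n + 2) → R) :
        (Fin.cons x fun i => -v i.succ : Fin (n + 2) → R) ∘ Fin.succ = -(v ∘ Fin.succ) := rfl
    simp only [suslinBar, suslin, cons_neg_comp, suslin_neg, Fin.cons_zero,
      Matrix.transpose_neg, neg_neg]
end

section
/- Let R be a commutative ring and P an R-module. Write elements of P ⊕ R as (p, a) and elements of (P ⊕ R)^∨ as pairs (f, b) with f ∈ P^∨, b ∈ R, acting by (f,b)(p,a) = f(p) + ba. Let e = (0, 1) ∈ P ⊕ R and ε = (0, 1) ∈ (P ⊕ R)^∨ (so ε(p,a) = a). Then for all p ∈ P, a, b ∈ R, and f ∈ P^∨, the endomorphisms of Λ(P ⊕ R) satisfy (l_{(p,a)} + d_{(f,b)}) ∘ (l_e + d_ε) = (l_e + d_ε) ∘ (l_{(−p,b)} + d_{(−f,a)}). (This is the operator form of the identity \overline{S(p,a,f,b)} = S(−p,b,−f,a) for generalized Suslin endomorphisms.) -/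
/-- Left exterior multiplication `l_m : Λ(M) → Λ(M)`, `ω ↦ m ∧ ω`. -/
noncomputable def lMul {R M : Type*} [CommRing R] [AddCommGroup M] [Module R M] (m : M) :
    Module.End R (ExteriorAlgebra R M) :=
  LinearMap.mulLeft R (ExteriorAlgebra.ι R m)

/-- Contraction (interior product) `d_f : Λ(M) → Λ(M)` by a dual vector `f ∈ M^∨`;
it is the unique `R`-linear map with
`d_f(m₁ ∧ … ∧ m_r) = Σᵢ (−1)^{i+1} f(mᵢ) · m₁ ∧ … ∧ m̂ᵢ ∧ … ∧ m_r` and `d_f(1) = 0`. -/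
noncomputable def dContr {R M : Type*} [CommRing R] [AddCommGroup M] [Module R M]
    (f : Module.Dual R M) : Module.End R (ExteriorAlgebra R M) :=
  CliffordAlgebra.contractLeft (Q := (0 : QuadraticForm R M)) f

/-- The dual vector `(f, b) ∈ (P ⊕ R)^∨` acting by `(f,b)(p,a) = f(p) + ba`. -/
noncomputable def dualPair {R P : Type*} [CommRing R] [AddCommGroup P] [Module R P]
    (f : Module.Dual R P) (b : R) : Module.Dual R (P × R) :=
  f ∘ₗ LinearMap.fst R P R + b • LinearMap.snd R P R

section Anticommutation

variable {R M : Type*} [CommRing R] [AddCommGroup M] [Module R M]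

theorem lMul_add (m n : M) : lMul (R := R) (m + n) = lMul m + lMul n := by
  refine LinearMap.ext fun x => ?_
  simp [lMul, add_mul]

theorem lMul_smul (r : R) (m : M) : lMul (r • m) = r • lMul (R := R) m := by
  refine LinearMap.ext fun x => ?_
  simp [lMul]

theorem lMul_neg (m : M) : lMul (R := R) (-m) = -lMul m := by
  refine LinearMap.ext fun x => ?_
  simp [lMul]

theorem dContr_add (f g : Module.Dual R M) : dContr (f + g) = dContr f + dContr g := by
  simp [dContr]

theorem dContr_smul (r : R) (f : Module.Dual R M) : dContr (r • f) = r • dContr f := by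
  simp [dContr]

theorem dContr_neg (f : Module.Dual R M) : dContr (-f) = -dContr f := by
  simp [dContr]

theorem lMul_mul_self (m : M) : lMul (R := R) m * lMul m = 0 := by
  refine LinearMap.ext fun x => ?_
  simp [lMul, ← mul_assoc]

theorem lMul_mul_lMul (m n : M) : lMul (R := R) m * lMul n = -(lMul n * lMul m) := by
  refine LinearMap.ext fun x => ?_
  have h := eq_neg_of_add_eq_zero_left (ExteriorAlgebra.ι_add_mul_swap (R := R) m n)
  simp [lMul, ← mul_assoc, h]

theorem dContr_mul_self (f : Module.Dual R M) : dContr f * dContr f = 0 :=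
  LinearMap.ext fun x => CliffordAlgebra.contractLeft_contractLeft f x

theorem dContr_mul_dContr (f g : Module.Dual R M) :
    dContr f * dContr g = -(dContr g * dContr f) :=
  LinearMap.ext fun x => CliffordAlgebra.contractLeft_comm f g x

theorem dContr_mul_lMul (f : Module.Dual R M) (m : M) :
    dContr f * lMul m = f m • 1 - lMul m * dContr f :=
  LinearMap.ext fun x => CliffordAlgebra.contractLeft_ι_mul f m x

end Anticommutation

theorem lMul_prodMk {R P : Type*} [CommRing R] [AddCommGroup P] [Module R P] (p : P) (a : R) :
    lMul (R := R) ((p, a) : P × R) =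
      lMul ((p, 0) : P × R) + a • lMul ((0, 1) : P × R) := by
  rw [← lMul_smul, ← lMul_add]
  simp

theorem dContr_dualPair {R P : Type*} [CommRing R] [AddCommGroup P] [Module R P]
    (f : Module.Dual R P) (b : R) :
    dContr (dualPair f b) =
      dContr (f ∘ₗ LinearMap.fst R P R) + b • dContr (LinearMap.snd R P R) := by
  rw [dualPair, dContr_add, dContr_smul]

/-- with `e = (0,1) ∈ P ⊕ R` and `ε = (0,1) ∈ (P ⊕ R)^∨` (so `ε(p,a) = a`),
for all `p ∈ P`, `a, b ∈ R`, `f ∈ P^∨`: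
`(l_{(p,a)} + d_{(f,b)}) ∘ (l_e + d_ε) = (l_e + d_ε) ∘ (l_{(−p,b)} + d_{(−f,a)})`. -/
theorem suslinEndo_conj_eq {R P : Type*} [CommRing R] [AddCommGroup P] [Module R P]
    (p : P) (a b : R) (f : Module.Dual R P) :
    (lMul ((p, a) : P × R) + dContr (dualPair f b)) ∘ₗ
        (lMul ((0, 1) : P × R) + dContr (LinearMap.snd R P R))
      = (lMul ((0, 1) : P × R) + dContr (LinearMap.snd R P R)) ∘ₗ
        (lMul ((-p, b) : P × R) + dContr (dualPair (-f) a)) := by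
  have hp : lMul (R := R) ((-p, 0) : P × R) = -lMul ((p, 0) : P × R) := by
    rw [← lMul_neg]
    simp
  have mul_neg_end (A B : Module.End R (ExteriorAlgebra R (P × R))) : A * -B = -(A * B) :=
    LinearMap.ext fun x => map_neg A (B x)
  have hpe := lMul_mul_lMul (R := R) ((p, 0) : P × R) (0, 1)
  have hpε := dContr_mul_lMul (LinearMap.snd R P R) (p, 0)
  have hfe := dContr_mul_lMul (f ∘ₗ LinearMap.fst R P R) (0, 1)
  have hfε := dContr_mul_dContr (f ∘ₗ LinearMap.fst R P R) (LinearMap.snd R P R)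
  simp only [LinearMap.snd_apply, LinearMap.comp_apply, LinearMap.fst_apply, map_zero, zero_smul,
    zero_sub] at hpε hfe
  rw [lMul_prodMk p a, lMul_prodMk (-p) b, hp, dContr_dualPair, dContr_dualPair,
    LinearMap.neg_comp, dContr_neg, ← Module.End.mul_eq_comp, ← Module.End.mul_eq_comp]
  simp only [add_mul, mul_add, mul_neg_end, smul_mul_assoc, mul_smul_comm, lMul_mul_self,
    dContr_mul_self, hpe, hpε, hfe, hfε, smul_zero]
  abel_nf
end

section
/- Let R be a commutative ring and P a finitely generated projective R-module. Let e = (0,1) ∈ P ⊕ R, ε ∈ (P ⊕ R)^∨ with ε(p, a) = a, and for p ∈ P, a, b ∈ R, f ∈ P^∨ consider the endomorphism S = (l_e + d_ε) ∘ (l_{(p,a)} + d_{(f,b)}) of Λ(P ⊕ R), where (f,b) ∈ (P ⊕ R)^∨ acts by (f,b)(p',a') = f(p') + ba'. Then S is an automorphism of Λ(P ⊕ R) if and only if q = f(p) + ab is a unit of R. -/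
/-- The operators `l_m + d_g` satisfy the Clifford relation `(l_m + d_g)² = g(m)`. -/
theorem lMul_add_dContr_sq {R M : Type*} [CommRing R] [AddCommGroup M] [Module R M]
    (m : M) (g : Module.Dual R M) :
    (lMul m + dContr g) ^ 2 = algebraMap R (Module.End R (ExteriorAlgebra R M)) (g m) := by
  refine LinearMap.ext fun x => ?_
  have hm : ExteriorAlgebra.ι R m * (ExteriorAlgebra.ι R m * x) = 0 := by
    rw [← mul_assoc, ExteriorAlgebra.ι_sq_zero, zero_mul]
  have hg : dContr g (dContr g x) = 0 :=
    CliffordAlgebra.contractLeft_contractLeft (Q := (0 : QuadraticForm R M)) g x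
  have hmg : dContr g (ExteriorAlgebra.ι R m * x)
      = g m • x - ExteriorAlgebra.ι R m * dContr g x :=
    CliffordAlgebra.contractLeft_ι_mul (Q := (0 : QuadraticForm R M)) (d := g) m x
  simp only [pow_two, Module.End.mul_apply, LinearMap.add_apply, lMul, LinearMap.mulLeft_apply,
    mul_add, hm, hg, hmg, Module.algebraMap_end_apply]
  abel

/-- A scalar acts invertibly on an exterior algebra exactly when it is a unit. -/
theorem isUnit_algebraMap_end_exteriorAlgebra_iff {R M : Type*} [CommRing R] [AddCommGroup M]
    [Module R M] (r : R) :
    IsUnit (algebraMap R (Module.End R (ExteriorAlgebra R M)) r) ↔ IsUnit r := by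
  refine ⟨fun h => ?_, fun h => h.map _⟩
  obtain ⟨x, hx⟩ := ((Module.End.isUnit_iff _).1 h).2 1
  refine IsUnit.of_mul_eq_one (ExteriorAlgebra.algebraMapInv x) ?_
  simpa using congrArg ExteriorAlgebra.algebraMapInv hx

/-- `l_m + d_g` is an automorphism of `Λ(M)` if and only if `g(m)` is a unit. -/
theorem isUnit_lMul_add_dContr_iff {R M : Type*} [CommRing R] [AddCommGroup M] [Module R M]
    (m : M) (g : Module.Dual R M) : IsUnit (lMul m + dContr g) ↔ IsUnit (g m) := by
  rw [← isUnit_pow_iff two_ne_zero, lMul_add_dContr_sq,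
    isUnit_algebraMap_end_exteriorAlgebra_iff]

/-- for a finitely generated projective `R`-module `P`, with
`e = (0,1) ∈ P ⊕ R` and `ε(p,a) = a`, the generalized Suslin endomorphism
`S = (l_e + d_ε) ∘ (l_{(p,a)} + d_{(f,b)})` of `Λ(P ⊕ R)` is an automorphism if and only
if `q = f(p) + ab` is a unit of `R`. -/
theorem isUnit_suslinEndo_iff {R P : Type*} [CommRing R] [AddCommGroup P] [Module R P]
    [Module.Finite R P] [Module.Projective R P]
    (p : P) (a b : R) (f : Module.Dual R P) :
    IsUnit ((lMul ((0, 1) : P × R) + dContr (LinearMap.snd R P R)) ∘ₗ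
        (lMul ((p, a) : P × R) + dContr (dualPair f b)) :
        Module.End R (ExteriorAlgebra R (P × R)))
      ↔ IsUnit (f p + a * b) := by
  have he : IsUnit (lMul ((0, 1) : P × R) + dContr (LinearMap.snd R P R)) :=
    (isUnit_lMul_add_dContr_iff _ _).2 (by simp)
  rw [← Module.End.mul_eq_comp, he.mul_left_iff, isUnit_lMul_add_dContr_iff]
  simp [dualPair, mul_comm]
end
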